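/- arXiv:1206.3390 — 2 statements merged into one kernel-verified Lean document; each statement's English description precedes it below -/
import Mathlib

section
/- For every δ>0 there exists n₀∈ℕ such that for all n≥n₀ and all b>n^{β+ε}: exp(Λ_b(θ_{n,b})) ≤ 1 + (1+δ)/n. -/
open MeasureTheory ProbabilityTheory Filter

noncomputable section

/-- Right tail `F̄(x) = F((x,∞))` of a measure on `ℝ`, as a real number. -/
def rtail (F : Measure ℝ) (x : ℝ) : ℝ := (F (Set.Ioi x)).toReal

/-- `L` is slowly varying at infinity. -/
def SlowlyVarying (L : ℝ → ℝ) : Prop :=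
  ∀ t > 0, Tendsto (fun x => L (t * x) / L x) atTop (nhds 1)

/-- The twisting parameter `θ_{n,b} = -log(n F̄(b)) / b`. -/
def theta (F : Measure ℝ) (n : ℕ) (b : ℝ) : ℝ := -Real.log ((n : ℝ) * rtail F b) / b

/-- The truncated log-moment generating function `Λ_b(θ) = log ∫_{(-∞,b]} e^{θx} dF(x)`. -/
def Lam (F : Measure ℝ) (b θ : ℝ) : ℝ :=
  Real.log (∫ x in Set.Iic b, Real.exp (θ * x) ∂F)

lemma exp_le_one_add_add_abs_rpow {κ y : ℝ} (h1 : 1 ≤ κ) (h2 : κ ≤ 2) (hy : y ≤ 1) :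
    Real.exp y ≤ 1 + y + |y| ^ κ := by
  rcases le_or_gt |y| 1 with h | h
  · have := (abs_le.mp (Real.abs_exp_sub_one_sub_id_le h)).2
    have h3 : y ^ 2 ≤ |y| ^ κ := by
      rcases eq_or_ne y 0 with rfl | h0
      · simp; positivity
      · have := Real.rpow_le_rpow_of_exponent_ge (abs_pos.mpr h0) h h2
        rw [Real.rpow_two, sq_abs] at this
        exact this
    linarith
  · have hneg : y < 0 := by
      by_contra! h0
      rw [abs_of_nonneg h0] at h
      linarith
    have h3 : |y| ≤ |y| ^ κ := by
      simpa using Real.rpow_le_rpow_of_exponent_le h.le h1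
    have h4 : Real.exp y ≤ 1 := Real.exp_le_one_iff.mpr hneg.le
    rw [abs_of_neg hneg] at h3 ⊢
    linarith

lemma rtail_antitone (F : Measure ℝ) [IsFiniteMeasure F] : Antitone (rtail F) := fun _ _ h =>
  ENNReal.toReal_mono (measure_ne_top _ _) (measure_mono (Set.Ioi_subset_Ioi h))

lemma tendsto_ratio_of_slowlyVarying {g L : ℝ → ℝ} {α : ℝ} (hL : SlowlyVarying L)
    (hg : ∀ x > 0, g x = L x * x ^ (-α)) {t : ℝ} (ht : 0 < t) :
    Tendsto (fun x => g (t * x) / g x) atTop (nhds (t ^ (-α))) := by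
  have h := (hL t ht).mul_const (t ^ (-α))
  rw [one_mul] at h
  refine h.congr' ?_
  filter_upwards [eventually_gt_atTop 0] with x hx
  rw [hg x hx, hg (t * x) (by positivity), Real.mul_rpow ht.le hx.le]
  have : x ^ (-α) ≠ 0 := (Real.rpow_pos_of_pos hx _).ne'
  rw [← mul_assoc, mul_div_mul_right _ _ this, div_mul_eq_mul_div]

/-- A one-sided Potter bound for antitone functions satisfying a doubling condition. -/
lemma potter_bound {g : ℝ → ℝ} (hg : Antitone g) (hpos : ∀ x > 0, 0 < g x) {a X : ℝ}
    (ha : 0 ≤ a) (hX : 0 < X) (hdouble : ∀ x ≥ X, g (x / 2) ≤ 2 ^ a * g x)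
    {lam x : ℝ} (hlam : 1 ≤ lam) (hx : X * lam ≤ x) :
    g (x / lam) ≤ 2 ^ a * lam ^ a * g x := by
  obtain ⟨k, hk⟩ := pow_unbounded_of_one_lt lam (one_lt_two : (1 : ℝ) < 2)
  induction k generalizing lam x with
  | zero => rw [pow_zero] at hk; linarith
  | succ k ih =>
    have hXx : X ≤ x := le_trans (by nlinarith) hx
    have hx0 : 0 < x := hX.trans_le hXx
    have hgx := hpos x hx0
    have h2a : (0 : ℝ) < 2 ^ a := by positivity
    rcases le_or_gt lam 2 with h | h
    · calc g (x / lam) ≤ g (x / 2) := hg (by gcongr)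
        _ ≤ 2 ^ a * g x := hdouble x hXx
        _ ≤ 2 ^ a * lam ^ a * g x := by
          have : 1 ≤ lam ^ a := Real.one_le_rpow hlam ha
          gcongr
          exact le_mul_of_one_le_right h2a.le this
    · have h1 := ih (lam := lam / 2) (x := x / 2) (by linarith) (by linarith)
        (by rw [pow_succ] at hk; linarith)
      rw [show x / 2 / (lam / 2) = x / lam by field_simp,
        Real.div_rpow (by linarith) two_pos.le, mul_div_cancel₀ _ h2a.ne'] at h1
      calc g (x / lam) ≤ lam ^ a * g (x / 2) := h1
        _ ≤ lam ^ a * (2 ^ a * g x) := by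
          gcongr
          exact hdouble x hXx
        _ = 2 ^ a * lam ^ a * g x := by ring

lemma rtail_mul_rpow_le {F : Measure ℝ} [IsFiniteMeasure F] {κ b : ℝ} (hκ : 0 ≤ κ) (hb : 0 ≤ b)
    (hmom : Integrable (fun x => |x| ^ κ) F) :
    rtail F b * b ^ κ ≤ ∫ x, |x| ^ κ ∂F := by
  have h := mul_meas_ge_le_integral_of_nonneg (μ := F) (f := fun x => |x| ^ κ)
    (ae_of_all _ fun x => by positivity) hmom (b ^ κ)
  rw [mul_comm] at h
  refine le_trans ?_ h
  gcongr
  refine ENNReal.toReal_mono (measure_ne_top _ _) (measure_mono fun x hx => ?_)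
  have hx : b < x := hx
  have : b ≤ |x| := hx.le.trans (le_abs_self x)
  exact Real.rpow_le_rpow hb this hκ

lemma setIntegral_exp_le {F : Measure ℝ} [IsProbabilityMeasure F]
    (hmeanInt : Integrable (fun x => x) F) (hmean : ∫ x, x ∂F = 0) {κ : ℝ} (h1 : 1 ≤ κ)
    (h2 : κ ≤ 2) (hmom : Integrable (fun x => |x| ^ κ) F) {b θ r : ℝ} (hθ : 0 < θ) :
    ∫ x in Set.Iic b, Real.exp (θ * x) ∂F ≤
      1 + θ ^ κ * (∫ x, |x| ^ κ ∂F) + Real.exp (θ * r) * rtail F (1 / θ)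
        + Real.exp (θ * b) * rtail F r := by
  have i0 : Integrable (fun x => 1 + θ * x) F :=
    (integrable_const 1).add (hmeanInt.const_mul θ)
  have i1 : Integrable (fun x => 1 + θ * x + θ ^ κ * |x| ^ κ) F :=
    i0.add (hmom.const_mul _)
  have ind : ∀ s t : ℝ, Integrable ((Set.Ioi s).indicator fun _ => t) F := fun s t =>
    (integrable_const t).indicator measurableSet_Ioi
  have i2 : Integrable (fun x => 1 + θ * x + θ ^ κ * |x| ^ κ
      + (Set.Ioi (1 / θ)).indicator (fun _ => Real.exp (θ * r)) x) F := i1.add (ind _ _)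
  have iexp : Integrable ((Set.Iic b).indicator fun x => Real.exp (θ * x)) F := by
    refine Integrable.of_bound (C := Real.exp (θ * b)) ?_ (ae_of_all _ fun x => ?_)
    · exact (Measurable.indicator (by fun_prop) measurableSet_Iic).aestronglyMeasurable
    · by_cases hx : x ≤ b
      · rw [Set.indicator_of_mem (show x ∈ Set.Iic b from hx), Real.norm_eq_abs, Real.abs_exp]
        gcongr
      · rw [Set.indicator_of_notMem (show x ∉ Set.Iic b from hx), norm_zero]
        positivity
  have key : ∫ x, (Set.Iic b).indicator (fun x => Real.exp (θ * x)) x ∂F ≤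
      ∫ x, (1 + θ * x + θ ^ κ * |x| ^ κ
        + (Set.Ioi (1 / θ)).indicator (fun _ => Real.exp (θ * r)) x)
        + (Set.Ioi r).indicator (fun _ => Real.exp (θ * b)) x ∂F := by
    refine integral_mono iexp (i2.add (ind _ _)) fun x => ?_
    have hA : 0 ≤ θ ^ κ * |x| ^ κ := by positivity
    have hB : 0 ≤ (Set.Ioi (1 / θ)).indicator (fun _ => Real.exp (θ * r)) x :=
      Set.indicator_nonneg (fun _ _ => by positivity) _
    have hC : 0 ≤ (Set.Ioi r).indicator (fun _ => Real.exp (θ * b)) x :=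
      Set.indicator_nonneg (fun _ _ => by positivity) _
    have hle : (Set.Iic b).indicator (fun x => Real.exp (θ * x)) x ≤ Real.exp (θ * x) :=
      Set.indicator_le_self' (fun _ _ => by positivity) x
    rcases le_or_gt x (1 / θ) with hx | hx
    · have hy : θ * x ≤ 1 := by rwa [le_div_iff₀ hθ, mul_comm] at hx
      have h3 := exp_le_one_add_add_abs_rpow h1 h2 hy
      rw [abs_mul, abs_of_pos hθ, Real.mul_rpow hθ.le (abs_nonneg x)] at h3
      dsimp only
      linarith
    · have hy : 1 < θ * x := by rwa [div_lt_iff₀ hθ, mul_comm] at hx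
      rcases le_or_gt x r with hr | hr
      · rw [Set.indicator_of_mem (show x ∈ Set.Ioi (1 / θ) from hx)]
        have : Real.exp (θ * x) ≤ Real.exp (θ * r) := by gcongr
        linarith
      · rw [Set.indicator_of_mem (show x ∈ Set.Ioi r from hr)]
        have : (Set.Iic b).indicator (fun x => Real.exp (θ * x)) x ≤ Real.exp (θ * b) := by
          by_cases hxb : x ≤ b
          · exact hle.trans (by gcongr)
          · rw [Set.indicator_of_notMem (show x ∉ Set.Iic b from hxb)]
            positivity
        linarith
  rw [integral_indicator measurableSet_Iic, integral_add i2 (ind _ _),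
    integral_add i1 (ind _ _),
    integral_add i0 (hmom.const_mul _),
    integral_add (integrable_const 1) (hmeanInt.const_mul θ), integral_const_mul,
    integral_const_mul, hmean, integral_indicator_const _ measurableSet_Ioi,
    integral_indicator_const _ measurableSet_Ioi] at key
  simp only [integral_const, smul_eq_mul, probReal_univ, mul_zero, mul_one, add_zero] at key
  unfold rtail
  simp only [Measure.real] at key
  linarith

/-- The estimate for a fixed truncation level `b`, in terms of `c = -log (n * rtail F b)`. -/
lemma setIntegral_exp_theta_le {F : Measure ℝ} [IsProbabilityMeasure F]
    (hmeanInt : Integrable (fun x => x) F) (hmean : ∫ x, x ∂F = 0) {κ : ℝ} (h1 : 1 ≤ κ)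
    (h2 : κ ≤ 2) (hmom : Integrable (fun x => |x| ^ κ) F) {b c ρ d K : ℝ} {n : ℕ} (hn : 0 < n)
    (hb : 0 < b) (hc : 0 < c) (hcb : Real.exp (-c) = n * rtail F b)
    (hmoment : n * (b ^ (-κ) * (c ^ κ * ∫ x, |x| ^ κ ∂F)) ≤ d)
    (hpotter : rtail F (b / c) ≤ K * rtail F b)
    (hK : K * Real.exp (-(1 - ρ) * c) ≤ d)
    (hratio : rtail F (ρ * b) ≤ (1 + d) * rtail F b) :
    ∫ x in Set.Iic b, Real.exp (c / b * x) ∂F ≤ 1 + (1 + 3 * d) / n := by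
  have hn' : (0 : ℝ) < n := by exact_mod_cast hn
  have hmain := setIntegral_exp_le hmeanInt hmean h1 h2 hmom (b := b) (r := ρ * b)
    (div_pos hc hb)
  rw [one_div_div, div_mul_cancel₀ _ hb.ne',
    show c / b * (ρ * b) = ρ * c by field_simp] at hmain
  have hgb : rtail F b = Real.exp (-c) / n := by rw [hcb]; field_simp
  have t1 : (c / b) ^ κ * (∫ x, |x| ^ κ ∂F) ≤ d / n := by
    rw [le_div_iff₀ hn', Real.div_rpow hc.le hb.le]
    rw [Real.rpow_neg hb.le] at hmoment
    calc _ = n * ((b ^ κ)⁻¹ * (c ^ κ * ∫ x, |x| ^ κ ∂F)) := by ring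
      _ ≤ d := hmoment
  have t2 : Real.exp (ρ * c) * rtail F (b / c) ≤ d / n := by
    calc _ ≤ Real.exp (ρ * c) * (K * rtail F b) := by gcongr
      _ = K * (Real.exp (ρ * c) * Real.exp (-c)) / n := by rw [hgb]; ring
      _ = K * Real.exp (-(1 - ρ) * c) / n := by rw [← Real.exp_add]; ring_nf
      _ ≤ d / n := by gcongr
  have t3 : Real.exp c * rtail F (ρ * b) ≤ (1 + d) / n := by
    calc _ ≤ Real.exp c * ((1 + d) * rtail F b) := by gcongr
      _ = (1 + d) * (Real.exp c * Real.exp (-c)) / n := by rw [hgb]; ring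
      _ = (1 + d) / n := by rw [← Real.exp_add]; simp
  calc _ ≤ _ := hmain
    _ ≤ 1 + d / n + d / n + (1 + d) / n := by gcongr
    _ = 1 + (1 + 3 * d) / n := by ring

lemma one_lt_moment_exponent {α β ε κ : ℝ} (hα : 1 < α) (hβ : β = 1 / min α 2) (hε : 0 < ε)
    (hκ : κ = if 2 < α then 2 else (1 + ε) / (1 / α + ε)) :
    0 < β + ε ∧ 1 < κ * (β + ε) ∧ 1 ≤ κ ∧ κ ≤ 2 := by
  have hα0 : 0 < α := by linarith
  split_ifs at hκ with h
  · rw [min_eq_right h.le] at hβ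
    subst hκ hβ
    refine ⟨?_, ?_, ?_, ?_⟩ <;> linarith
  · rw [min_eq_left (not_lt.mp h)] at hβ
    subst hκ hβ
    have h1 : 0 < 1 / α := by positivity
    have h2 : 1 / α < 1 := by rw [div_lt_one hα0]; exact hα
    have h3 : 1 / 2 ≤ 1 / α := one_div_le_one_div_of_le hα0 (not_lt.mp h)
    refine ⟨by linarith, ?_, ?_, ?_⟩
    · rw [div_mul_cancel₀ _ (by linarith)]; linarith
    · rw [le_div_iff₀ (by linarith)]; linarith
    · rw [div_le_iff₀ (by linarith)]; linarith

/-- For every `δ > 0`, for all sufficiently large `n` and all `b > n^{β+ε}`,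
`exp(Λ_b(θ_{n,b})) ≤ 1 + (1+δ)/n`. -/
theorem stmt3
    (F : Measure ℝ) [IsProbabilityMeasure F]
    (α : ℝ) (hα : 1 < α)
    (L : ℝ → ℝ) (hLpos : ∀ x > 0, 0 < L x) (hL : SlowlyVarying L)
    (htail : ∀ x > 0, rtail F x = L x * x ^ (-α))
    (hmeanInt : Integrable (fun x => x) F) (hmean : ∫ x, x ∂F = 0)
    (β : ℝ) (hβ : β = 1 / min α 2)
    (ε : ℝ) (hε : 0 < ε)
    (κ : ℝ) (hκ : κ = if 2 < α then 2 else (1 + ε) / (1 / α + ε))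
    (hmom : Integrable (fun x => |x| ^ κ) F) :
    ∀ δ > 0, ∃ n₀ : ℕ, ∀ n ≥ n₀, ∀ b > (n : ℝ) ^ (β + ε),
      Real.exp (Lam F b (theta F n b)) ≤ 1 + (1 + δ) / n := by
  intro δ hδ
  obtain ⟨hs, hκs, hκ1, hκ2⟩ := one_lt_moment_exponent hα hβ hε hκ
  set s := β + ε
  set M := ∫ x, |x| ^ κ ∂F
  have hα0 : 0 < α := by linarith
  have hgpos : ∀ x > 0, 0 < rtail F x := fun x hx => by
    rw [htail x hx]
    exact mul_pos (hLpos x hx) (Real.rpow_pos_of_pos hx _)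
  have hMpos : 0 < M := by
    have := rtail_mul_rpow_le (b := 1) (by linarith) zero_le_one hmom
    rw [Real.one_rpow, mul_one] at this
    exact (hgpos 1 one_pos).trans_le this
  obtain ⟨d, hd, rfl⟩ : ∃ d > 0, δ = 3 * d := ⟨δ / 3, by positivity, by ring⟩
  set η := κ - 1 / s with hη
  have hη0 : 0 < η := by
    rw [hη, sub_pos, div_lt_iff₀ hs]
    exact hκs
  obtain ⟨ρ, hρ0, hρ1, hρ⟩ : ∃ ρ : ℝ, 0 < ρ ∧ ρ < 1 ∧ ρ ^ (-α) < 1 + d := by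
    refine ⟨(1 + d / 2) ^ (-(1 / α)), by positivity, ?_, ?_⟩
    · exact Real.rpow_lt_one_of_one_lt_of_neg (by linarith) (by simpa using hα0)
    · rw [← Real.rpow_mul (by positivity), show -(1 / α) * -α = 1 by field_simp, Real.rpow_one]
      linarith
  obtain ⟨X, hX0, hX⟩ : ∃ X > 0, ∀ x ≥ X, rtail F (x / 2) ≤ 2 ^ (α + 1) * rtail F x := by
    have h := tendsto_ratio_of_slowlyVarying hL htail (t := 1 / 2) (by norm_num)
    have hlt : ((1 : ℝ) / 2) ^ (-α) < 2 ^ (α + 1) := by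
      rw [one_div, Real.inv_rpow two_pos.le, ← Real.rpow_neg two_pos.le, neg_neg]
      exact Real.rpow_lt_rpow_of_exponent_lt one_lt_two (by linarith)
    obtain ⟨X, hX⟩ := eventually_atTop.mp (h.eventually_lt_const hlt)
    refine ⟨max X 1, by positivity, fun x hx => ?_⟩
    have h1 := hX x ((le_max_left _ _).trans hx)
    rw [div_lt_iff₀ (hgpos x (one_pos.trans_le ((le_max_right _ _).trans hx)))] at h1
    rw [show x / 2 = 1 / 2 * x by ring]
    exact h1.le
  have hpot : ∀ {lam x : ℝ}, 1 ≤ lam → X * lam ≤ x →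
      rtail F (x / lam) ≤ 2 ^ (α + 1) * lam ^ (α + 1) * rtail F x :=
    potter_bound (rtail_antitone F) hgpos (by linarith) hX0 hX
  obtain ⟨c₀, hc₀⟩ : ∃ c₀ : ℝ, ∀ c ≥ c₀,
      2 ^ (α + 1) * c ^ (α + 1) * Real.exp (-(1 - ρ) * c) ≤ d := by
    have h := (tendsto_rpow_mul_exp_neg_mul_atTop_nhds_zero (α + 1) (1 - ρ)
      (by linarith)).const_mul ((2 : ℝ) ^ (α + 1))
    rw [mul_zero] at h
    obtain ⟨c₀, hc₀⟩ := eventually_atTop.mp (h.eventually_le_const hd)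
    exact ⟨c₀, fun c hc => by rw [mul_assoc]; exact hc₀ c hc⟩
  have e1 : ∀ᶠ b in atTop, rtail F (ρ * b) ≤ (1 + d) * rtail F b := by
    filter_upwards [(tendsto_ratio_of_slowlyVarying hL htail hρ0).eventually_lt_const hρ,
      eventually_gt_atTop 0] with b hb hb0
    rw [div_lt_iff₀ (hgpos b hb0)] at hb
    exact hb.le
  have e2 : ∀ᶠ b in atTop, max c₀ 1 + Real.log M ≤ η * Real.log b :=
    (Real.tendsto_log_atTop.const_mul_atTop hη0).eventually_ge_atTop _
  have e3 : ∀ᶠ b in atTop,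
      Real.log (2 ^ (α + 1) / X ^ (α + 1) / rtail F X) ≤ Real.log b :=
    Real.tendsto_log_atTop.eventually_ge_atTop _
  have e4 : ∀ᶠ b in atTop, X * ((α + 2) * Real.log b) ≤ b := by
    have h := Real.isLittleO_log_id_atTop.bound (c := (X * (α + 2))⁻¹) (by positivity)
    filter_upwards [h, eventually_ge_atTop 1] with b hb hb1
    rw [Real.norm_of_nonneg (Real.log_nonneg hb1), id, Real.norm_of_nonneg (by linarith),
      inv_mul_eq_div, le_div_iff₀ (by positivity)] at hb
    linarith
  have e5 : ∀ᶠ b in atTop, ((α + 2) * Real.log b) ^ κ * M ≤ d * b ^ η := by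
    have h := (isLittleO_log_rpow_rpow_atTop κ hη0).bound
      (c := d / ((α + 2) ^ κ * M)) (by positivity)
    filter_upwards [h, eventually_ge_atTop 1] with b hb hb1
    have hl := Real.log_nonneg hb1
    rw [Real.norm_of_nonneg (by positivity), Real.norm_of_nonneg (by positivity),
      div_mul_eq_mul_div, le_div_iff₀ (by positivity)] at hb
    rw [Real.mul_rpow (by linarith) hl]
    linarith
  obtain ⟨B, hB⟩ := eventually_atTop.mp (e1.and (e2.and (e3.and (e4.and (e5.and
    (eventually_ge_atTop (max X 1)))))))
  have e6 : ∀ᶠ n : ℕ in atTop, B ≤ (n : ℝ) ^ s :=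
    ((tendsto_rpow_atTop hs).comp tendsto_natCast_atTop_atTop).eventually_ge_atTop B
  obtain ⟨n₀, hn₀⟩ := eventually_atTop.mp (e6.and (eventually_gt_atTop 0))
  refine ⟨n₀, fun n hn b hb => ?_⟩
  obtain ⟨hBn, hnpos⟩ := hn₀ n hn
  obtain ⟨b1, b2, b3, b4, b5, b6⟩ := hB b (hBn.trans hb.le)
  have hXb : X ≤ b := (le_max_left _ _).trans b6
  have hb1 : 1 ≤ b := (le_max_right _ _).trans b6
  have hb0 : 0 < b := by linarith
  have hn1 : (1 : ℝ) ≤ n := by exact_mod_cast hnpos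
  have hn0 : (0 : ℝ) < n := by linarith
  have hg := hgpos b hb0
  have hnb : n * b ^ (-κ) ≤ b ^ (-η) := by
    have h1 : (n : ℝ) ≤ b ^ (1 / s) := by
      have := Real.rpow_le_rpow (by positivity) hb.le (show 0 ≤ 1 / s by positivity)
      rwa [← Real.rpow_mul hn0.le, mul_one_div_cancel hs.ne', Real.rpow_one] at this
    calc n * b ^ (-κ) ≤ b ^ (1 / s) * b ^ (-κ) := by gcongr
      _ = b ^ (-η) := by rw [← Real.rpow_add hb0, hη]; ring_nf
  set c := -Real.log (n * rtail F b) with hc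
  have hcb : Real.exp (-c) = n * rtail F b := by rw [hc, neg_neg, Real.exp_log (by positivity)]
  have hclow : max c₀ 1 ≤ c := by
    have h1 : n * rtail F b ≤ M * b ^ (-η) := by
      have h2 : rtail F b ≤ M * b ^ (-κ) := by
        rw [Real.rpow_neg hb0.le, ← div_eq_mul_inv, le_div_iff₀ (by positivity)]
        exact rtail_mul_rpow_le (by linarith) hb0.le hmom
      calc n * rtail F b ≤ n * (M * b ^ (-κ)) := by gcongr
        _ = M * (n * b ^ (-κ)) := by ring
        _ ≤ M * b ^ (-η) := by gcongr
    have h3 := Real.log_le_log (by positivity) h1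
    rw [Real.log_mul hMpos.ne' (by positivity), Real.log_rpow hb0] at h3
    rw [hc]
    linarith
  have hc1 : 1 ≤ c := (le_max_right _ _).trans hclow
  have hcup : c ≤ (α + 2) * Real.log b := by
    have h1 := hpot (lam := b / X) (x := b) ((one_le_div hX0).mpr hXb)
      (mul_div_cancel₀ b hX0.ne').le
    rw [div_div_cancel₀ hb0.ne', Real.div_rpow hb0.le hX0.le] at h1
    have hgX := hgpos X hX0
    have h2 : (rtail F b)⁻¹ ≤ 2 ^ (α + 1) / X ^ (α + 1) / rtail F X * b ^ (α + 1) := by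
      rw [inv_le_iff_one_le_mul₀ hg]
      calc 1 = rtail F X / rtail F X := (div_self hgX.ne').symm
        _ ≤ 2 ^ (α + 1) * (b ^ (α + 1) / X ^ (α + 1)) * rtail F b / rtail F X := by gcongr
        _ = _ := by ring
    have h3 := Real.log_le_log (by positivity) h2
    rw [Real.log_inv, Real.log_mul (by positivity) (by positivity), Real.log_rpow hb0] at h3
    have h4 : Real.log (rtail F b) ≤ Real.log (n * rtail F b) :=
      Real.log_le_log hg (le_mul_of_one_le_left hg.le hn1)
    rw [hc]
    linarith
  have hmoment : n * (b ^ (-κ) * (c ^ κ * M)) ≤ d := by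
    calc n * (b ^ (-κ) * (c ^ κ * M)) = n * b ^ (-κ) * (c ^ κ * M) := by ring
      _ ≤ b ^ (-η) * (((α + 2) * Real.log b) ^ κ * M) := by gcongr
      _ ≤ b ^ (-η) * (d * b ^ η) := by gcongr
      _ = d * (b ^ (-η) * b ^ η) := by ring
      _ = d := by rw [← Real.rpow_add hb0]; simp
  have hfin := setIntegral_exp_theta_le hmeanInt hmean hκ1 hκ2 hmom hnpos hb0 (by linarith) hcb
    hmoment (hpot hc1 ((mul_le_mul_of_nonneg_left hcup hX0.le).trans b4))
    (hc₀ c ((le_max_left _ _).trans hclow)) b1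
  have hnonneg : 0 ≤ ∫ x in Set.Iic b, Real.exp (c / b * x) ∂F :=
    integral_nonneg fun x => by positivity
  unfold Lam theta
  rw [← hc]
  rcases hnonneg.eq_or_lt with h0 | h0
  · rw [← h0, Real.log_zero, Real.exp_zero]
    exact le_add_of_nonneg_right (by positivity)
  · rwa [Real.exp_log h0]
end
end

section
/- If moreover α>2, then for every ε>0 there exists b₀ such that for all b>b₀: Σ_{k≥1} p_k(b)·n_k ≤ ((r+ε)/(μ(α−2)))·b. In particular the expected number of increments generated per run of the randomized level-crossing algorithm, which is at most Σ_{k≥1}p_k(b)n_k, is O(b). -/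
open MeasureTheory ProbabilityTheory Filter

noncomputable section

/-- Integrated tail `F̄_I(x) = ∫_x^∞ F̄(u) du`. -/
def rtailI (F : Measure ℝ) (x : ℝ) : ℝ := ∫ u in Set.Ioi x, rtail F u

/-- The block sizes `n_0 = 0`, `n_k = r^k` for `k ≥ 1`. -/
def nseq (r k : ℕ) : ℕ := if k = 0 then 0 else r ^ k

/-- The randomization probabilities
`p_k(b) = (F̄_I(b + n_{k-1}μ) − F̄_I(b + n_kμ)) / F̄_I(b)`. -/
def pk (F : Measure ℝ) (μ : ℝ) (r k : ℕ) (b : ℝ) : ℝ :=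
  (rtailI F (b + (nseq r (k - 1) : ℝ) * μ) - rtailI F (b + (nseq r k : ℝ) * μ)) /
    rtailI F b

/-- A nonnegative antitone function that contracts by a factor `c` under dilation by `t` has
controlled integrals over `[b, N]`, uniformly in `N`. -/
lemma Antitone.integral_mul_le_of_dilation_le {g : ℝ → ℝ} (hg : Antitone g) (hg0 : ∀ x, 0 ≤ g x)
    {t c b : ℝ} (ht : 1 < t) (hb : 0 < b) (hdil : ∀ u ≥ b, g (t * u) ≤ c * g u)
    {N : ℝ} (hN : b ≤ N) :
    (∫ u in b..N, g u) * (1 - c * t) ≤ (t - 1) * b * g b := by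
  have hint : ∀ x y, IntervalIntegrable g volume x y := fun x y => hg.intervalIntegrable
  have hbt : b ≤ t * b := by nlinarith
  have hNt : N ≤ t * N := by nlinarith
  have hsplit : (∫ u in b..N, g u) + (∫ u in N..(t * N), g u)
      = (∫ u in b..(t * b), g u) + ∫ u in (t * b)..(t * N), g u := by
    rw [intervalIntegral.integral_add_adjacent_intervals (hint _ _) (hint _ _),
      intervalIntegral.integral_add_adjacent_intervals (hint _ _) (hint _ _)]
  have hrest : 0 ≤ ∫ u in N..(t * N), g u :=
    intervalIntegral.integral_nonneg hNt fun u _ => hg0 u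
  have hfirst : (∫ u in b..(t * b), g u) ≤ (t - 1) * b * g b := by
    have h := intervalIntegral.integral_mono_on hbt (hint _ _)
      (intervalIntegrable_const (c := g b)) fun u hu => hg hu.1
    rw [intervalIntegral.integral_const, smul_eq_mul] at h
    linarith
  have hscale : (∫ u in (t * b)..(t * N), g u) ≤ c * t * ∫ u in b..N, g u := by
    have hcomp : Antitone fun u => g (t * u) := fun x y hxy =>
      hg (mul_le_mul_of_nonneg_left hxy (by linarith))
    have h := intervalIntegral.integral_mono_on hN hcomp.intervalIntegrable
      ((hint _ _).const_mul c) fun u hu => hdil u hu.1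
    rw [intervalIntegral.integral_const_mul] at h
    rw [← intervalIntegral.mul_integral_comp_mul_left, mul_comm c t, mul_assoc]
    exact mul_le_mul_of_nonneg_left h (by linarith)
  linarith

lemma Antitone.integrableOn_Ioi_of_dilation_le {g : ℝ → ℝ} (hg : Antitone g) (hg0 : ∀ x, 0 ≤ g x)
    {t c b : ℝ} (ht : 1 < t) (hct : c * t < 1) (hb : 0 < b)
    (hdil : ∀ u ≥ b, g (t * u) ≤ c * g u) (x : ℝ) :
    IntegrableOn g (Set.Ioi x) := by
  have htail : IntegrableOn g (Set.Ioi b) := by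
    refine integrableOn_Ioi_of_intervalIntegral_norm_bounded ((t - 1) * b * g b / (1 - c * t)) b
      (fun N => ?_) tendsto_id ?_
    · rcases le_total b N with h | h
      · exact (intervalIntegrable_iff_integrableOn_Ioc_of_le h).1 hg.intervalIntegrable
      · simp [Set.Ioc_eq_empty_of_le h]
    · filter_upwards [eventually_ge_atTop b] with N hN
      rw [le_div_iff₀ (by linarith)]
      simpa [Real.norm_of_nonneg (hg0 _)] using
        hg.integral_mul_le_of_dilation_le hg0 ht hb hdil hN
  rcases le_total b x with h | h
  · exact htail.mono_set (Set.Ioi_subset_Ioi h)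
  · rw [← Set.Ioc_union_Ioi_eq_Ioi h]
    exact ((intervalIntegrable_iff_integrableOn_Ioc_of_le h).1 hg.intervalIntegrable).union htail

lemma rtail_nonneg (F : Measure ℝ) (x : ℝ) : 0 ≤ rtail F x := ENNReal.toReal_nonneg

lemma rtailI_nonneg (F : Measure ℝ) (x : ℝ) : 0 ≤ rtailI F x :=
  integral_nonneg fun u => rtail_nonneg F u

lemma rtailI_antitone {F : Measure ℝ} (hint : ∀ x, IntegrableOn (rtail F) (Set.Ioi x)) :
    Antitone (rtailI F) := fun x _ h =>
  setIntegral_mono_set (hint x) (Eventually.of_forall fun u => rtail_nonneg F u)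
    (Set.Ioi_subset_Ioi h).eventuallyLE

lemma rtailI_pos {F : Measure ℝ} {x : ℝ} (hint : IntegrableOn (rtail F) (Set.Ioi x))
    (hpos : ∀ u > x, 0 < rtail F u) : 0 < rtailI F x := by
  rw [rtailI, setIntegral_pos_iff_support_of_nonneg_ae
    (Eventually.of_forall fun u => rtail_nonneg F u) hint]
  have h : Set.Ioi x ⊆ Function.support (rtail F) := fun u hu => (hpos u hu).ne'
  rw [Set.inter_eq_self_of_subset_right h, Real.volume_Ioi]
  exact ENNReal.zero_lt_top

lemma rtailI_dilation_le {F : Measure ℝ} (hint : ∀ x, IntegrableOn (rtail F) (Set.Ioi x))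
    {t c b : ℝ} (ht : 0 < t) (hdil : ∀ u ≥ b, rtail F (t * u) ≤ c * rtail F u) :
    rtailI F (t * b) ≤ c * t * rtailI F b := by
  have h := integral_comp_mul_left_Ioi (rtail F) b ht
  have hle : (∫ u in Set.Ioi b, rtail F (t * u)) ≤ ∫ u in Set.Ioi b, c * rtail F u :=
    setIntegral_mono_on ((integrableOn_Ioi_comp_mul_left_iff _ _ ht).2 (hint _))
      ((hint b).const_mul c) measurableSet_Ioi fun u hu => hdil u (le_of_lt hu)
  rw [h, integral_const_mul, smul_eq_mul, inv_mul_le_iff₀ ht] at hle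
  simp only [rtailI]
  linarith

/-- Near `t = 1` the map `t ↦ t ^ (2 - α)` lies below every line through `(1, 1)` of slope larger
than `2 - α`. -/
lemma exists_one_lt_rpow_lt {α K : ℝ} (hK : 0 < K) (hαK : 1 < K * (α - 2)) :
    ∃ t : ℝ, 1 < t ∧ t ^ (2 - α) < 1 - (t - 1) / K := by
  have hd : HasDerivAt (fun t : ℝ => t ^ (2 - α)) (2 - α) 1 := by
    simpa using Real.hasDerivAt_rpow_const (x := 1) (p := 2 - α) (Or.inl one_ne_zero)
  have hsub : Set.Ioi (1 : ℝ) ⊆ {1}ᶜ := fun t ht => (ne_of_gt ht : t ≠ 1)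
  have hslope := (hasDerivAt_iff_tendsto_slope.1 hd).mono_left (nhdsWithin_mono 1 hsub)
  have hlt : 2 - α < -K⁻¹ := by
    have : K⁻¹ < α - 2 := by rwa [inv_lt_iff_one_lt_mul₀' hK]
    linarith
  obtain ⟨t, hst, ht⟩ := ((hslope.eventually_lt_const hlt).and self_mem_nhdsWithin).exists
  have ht1 : (1 : ℝ) < t := ht
  refine ⟨t, ht1, ?_⟩
  rw [slope_def_field, div_lt_iff₀ (by linarith), Real.one_rpow] at hst
  rw [div_eq_inv_mul]
  linarith

lemma eventually_rtail_dilation_le {F : Measure ℝ} {α : ℝ} {L : ℝ → ℝ}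
    (hLpos : ∀ x > 0, 0 < L x) (hL : SlowlyVarying L)
    (htail : ∀ x > 0, rtail F x = L x * x ^ (-α)) {t c : ℝ} (ht : 0 < t) (hc : t ^ (-α) < c) :
    ∀ᶠ x in atTop, rtail F (t * x) ≤ c * rtail F x := by
  have htp : 0 < t ^ (-α) := Real.rpow_pos_of_pos ht _
  have h1 : 1 < c / t ^ (-α) := by rwa [one_lt_div htp]
  filter_upwards [(hL t ht).eventually_lt_const h1, eventually_gt_atTop 0] with x hx hx0
  rw [div_lt_div_iff₀ (hLpos x hx0) htp] at hx
  rw [htail x hx0, htail (t * x) (by positivity), Real.mul_rpow ht.le hx0.le]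
  have hxp : 0 < x ^ (-α) := Real.rpow_pos_of_pos hx0 _
  nlinarith

/-- Summation by parts compared with the integral of an antitone function. -/
lemma Antitone.sum_mul_sub_le_integral {g : ℝ → ℝ} (hg : Antitone g) {n : ℕ → ℝ}
    (hn : Monotone n) (hn0 : n 0 = 0) {μ : ℝ} (hμ : 0 ≤ μ) (b : ℝ) (m : ℕ) :
    μ * ((∑ k ∈ Finset.range m, n k * (g (b + n k * μ) - g (b + n (k + 1) * μ)))
      + n m * g (b + n m * μ)) ≤ ∫ u in b..(b + n m * μ), g u := by
  induction m with
  | zero => simp [hn0]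
  | succ m ih =>
    have hle : b + n m * μ ≤ b + n (m + 1) * μ := by
      have := mul_le_mul_of_nonneg_right (hn m.le_succ) hμ
      simpa using this
    rw [← intervalIntegral.integral_add_adjacent_intervals (b := b + n m * μ)
      hg.intervalIntegrable hg.intervalIntegrable, Finset.sum_range_succ]
    have h := intervalIntegral.integral_mono_on hle
      (intervalIntegrable_const (μ := volume) (c := g (b + n (m + 1) * μ)))
      hg.intervalIntegrable fun u hu => hg hu.2
    rw [intervalIntegral.integral_const, smul_eq_mul] at h
    linarith

lemma nseq_monotone {r : ℕ} (hr : 1 < r) : Monotone (nseq r) := by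
  refine monotone_nat_of_le_succ fun k => ?_
  rcases k with _ | k
  · simp [nseq]
  · simpa [nseq] using Nat.pow_le_pow_right (by omega) (by omega)

lemma nseq_succ_le (r k : ℕ) : nseq r (k + 1) ≤ r * nseq r k + if k = 0 then r else 0 := by
  rcases k with _ | k <;> simp [nseq, pow_succ']

lemma sum_pk_mul_nseq_le {F : Measure ℝ} (hG : Antitone (rtailI F)) {μ : ℝ} (hμ : 0 < μ) {r : ℕ}
    (hr : 1 < r) {b : ℝ} (hGb : 0 < rtailI F b) {K : ℝ}
    (hK : ∀ N ≥ b, (∫ u in b..N, rtailI F u) ≤ K * b * rtailI F b) (m : ℕ) :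
    ∑ k ∈ Finset.range m, pk F μ r (k + 1) b * (nseq r (k + 1) : ℝ) ≤ r / μ * (K * b) + r := by
  set n : ℕ → ℝ := fun k => (nseq r k : ℝ) with hn
  have hmono : Monotone n := fun i j h => Nat.cast_le.2 (nseq_monotone hr h)
  have hn0 : n 0 = 0 := by simp [hn, nseq]
  have hnn : ∀ k, 0 ≤ n k := fun k => Nat.cast_nonneg _
  set d : ℕ → ℝ := fun k => rtailI F (b + n k * μ) - rtailI F (b + n (k + 1) * μ) with hd
  have hd0 : ∀ k, 0 ≤ d k := fun k => sub_nonneg.2 <| hG <| by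
    have := mul_le_mul_of_nonneg_right (hmono k.le_succ) hμ.le
    simpa using this
  have hterm : ∀ k, pk F μ r (k + 1) b * n (k + 1)
      ≤ (r * (n k * d k) + if k = 0 then r * d 0 else 0) / rtailI F b := fun k => by
    have hsucc : n (k + 1) ≤ r * n k + if k = 0 then (r : ℝ) else 0 := by
      have := nseq_succ_le r k
      simp only [hn]
      exact_mod_cast this
    have heq : pk F μ r (k + 1) b * n (k + 1) = n (k + 1) * d k / rtailI F b := by
      simp only [pk, hd, hn, Nat.add_sub_cancel]
      ring
    rw [heq]
    refine div_le_div_of_nonneg_right ?_ hGb.le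
    refine (mul_le_mul_of_nonneg_right hsucc (hd0 k)).trans_eq ?_
    split_ifs with h
    · subst h; ring
    · ring
  have hparts := hG.sum_mul_sub_le_integral hmono hn0 hμ.le b m
  have hint := hK (b + n m * μ) (by have := mul_nonneg (hnn m) hμ.le; linarith)
  have hlast : 0 ≤ n m * rtailI F (b + n m * μ) := mul_nonneg (hnn m) (rtailI_nonneg F _)
  have hS : ∑ k ∈ Finset.range m, n k * d k ≤ K * b * rtailI F b / μ := by
    rw [le_div_iff₀ hμ]
    nlinarith
  have hfirst : ∑ k ∈ Finset.range m, (if k = 0 then r * d 0 else 0) ≤ r * rtailI F b := by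
    have hdG : d 0 ≤ rtailI F b := by
      have := rtailI_nonneg F (b + n 1 * μ)
      simp only [hd, hn0, zero_mul, add_zero, zero_add]
      linarith
    have h := mul_le_mul_of_nonneg_left hdG (Nat.cast_nonneg (α := ℝ) r)
    rw [Finset.sum_ite_eq']
    split_ifs
    · exact h
    · exact mul_nonneg (Nat.cast_nonneg _) hGb.le
  calc ∑ k ∈ Finset.range m, pk F μ r (k + 1) b * n (k + 1)
      ≤ ∑ k ∈ Finset.range m, (r * (n k * d k) + if k = 0 then r * d 0 else 0) / rtailI F b :=
        Finset.sum_le_sum fun k _ => hterm k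
    _ = (r * (∑ k ∈ Finset.range m, n k * d k)
          + ∑ k ∈ Finset.range m, (if k = 0 then r * d 0 else 0)) / rtailI F b := by
        rw [← Finset.sum_div, Finset.sum_add_distrib, Finset.mul_sum]
    _ ≤ (r * (K * b * rtailI F b / μ) + r * rtailI F b) / rtailI F b := by
        gcongr
    _ = r / μ * (K * b) + r := by
        field_simp

lemma pk_nonneg {F : Measure ℝ} (hG : Antitone (rtailI F)) {μ : ℝ} (hμ : 0 ≤ μ) {r : ℕ}
    (hr : 1 < r) (k : ℕ) (b : ℝ) : 0 ≤ pk F μ r k b := by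
  refine div_nonneg (sub_nonneg.2 (hG ?_)) (rtailI_nonneg F b)
  have h : (nseq r (k - 1) : ℝ) ≤ nseq r k := Nat.cast_le.2 (nseq_monotone hr (Nat.sub_le k 1))
  have := mul_le_mul_of_nonneg_right h hμ
  linarith

/-- If `α > 2`, then for every `ε > 0` and all large `b`,
`Σ_{k≥1} p_k(b) n_k ≤ ((r+ε)/(μ(α−2))) b`; in particular the expected number of increments
generated per run of the randomized level-crossing algorithm is `O(b)`. -/
theorem stmt15
    (F : Measure ℝ) [IsProbabilityMeasure F]
    (α : ℝ) (hα : 2 < α)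
    (L : ℝ → ℝ) (hLpos : ∀ x > 0, 0 < L x) (hL : SlowlyVarying L)
    (htail : ∀ x > 0, rtail F x = L x * x ^ (-α))
    (hmeanInt : Integrable (fun x => x) F) (hmean : ∫ x, x ∂F = 0)
    (μ : ℝ) (hμ : 0 < μ) (r : ℕ) (hr : 1 < r) :
    ∀ ε > 0, ∃ b₀ : ℝ, ∀ b > b₀,
      Summable (fun k : ℕ => pk F μ r (k + 1) b * (nseq r (k + 1) : ℝ)) ∧
      (∑' k : ℕ, pk F μ r (k + 1) b * (nseq r (k + 1) : ℝ)) ≤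
        (((r : ℝ) + ε) / (μ * (α - 2))) * b := by
  intro ε hε
  have hr0 : (0 : ℝ) < r := by exact_mod_cast (by omega : 0 < r)
  have hα2 : 0 < α - 2 := by linarith
  set K : ℝ := (r + ε / 2) / (r * (α - 2)) with hKdef
  have hK : 0 < K := by positivity
  have hαK : 1 < K * (α - 2) := by
    have h : K * (α - 2) = (r + ε / 2) / r := by rw [hKdef]; field_simp
    rw [h, one_lt_div hr0]
    linarith
  obtain ⟨t, ht, hlt⟩ := exists_one_lt_rpow_lt hK hαK
  have ht0 : 0 < t := by linarith
  set c : ℝ := (1 - (t - 1) / K) / t ^ 2 with hcdef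
  have hct2 : c * t * t = 1 - (t - 1) / K := by rw [hcdef]; field_simp
  have hc : t ^ (-α) < c := by
    have hexp : -α + ((2 : ℕ) : ℝ) = 2 - α := by push_cast; ring
    rw [hcdef, lt_div_iff₀ (by positivity), ← Real.rpow_natCast, ← Real.rpow_add ht0, hexp]
    exact hlt
  have hc0 : 0 < c := (Real.rpow_pos_of_pos ht0 _).trans hc
  have hfrac : 0 < (t - 1) / K := div_pos (by linarith) hK
  have hct : c * t < 1 := by nlinarith [mul_pos hc0 ht0]
  obtain ⟨b₁, hb₁⟩ :=
    eventually_atTop.1 (eventually_rtail_dilation_le hLpos hL htail ht0 hc)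
  have hint := (rtail_antitone F).integrableOn_Ioi_of_dilation_le (rtail_nonneg F) ht hct
    (lt_max_of_lt_right one_pos : 0 < max b₁ 1) fun u hu => hb₁ u ((le_max_left _ _).trans hu)
  have hG := rtailI_antitone hint
  refine ⟨max (max b₁ 1) (2 * r * (μ * (α - 2)) / ε), fun b hb => ?_⟩
  have hbb₁ : b₁ ≤ b := ((le_max_left _ _).trans (le_max_left _ _)).trans hb.le
  have hb0 : 0 < b :=
    one_pos.trans (((le_max_right b₁ 1).trans (le_max_left _ _)).trans_lt hb)
  have hbr : 2 * r * (μ * (α - 2)) / ε < b := (le_max_right _ _).trans_lt hb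
  have hGb : 0 < rtailI F b := rtailI_pos (hint b) fun u hu => by
    have hu0 : 0 < u := hb0.trans hu
    rw [htail u hu0]
    exact mul_pos (hLpos u hu0) (Real.rpow_pos_of_pos hu0 _)
  have hKint : ∀ N ≥ b, (∫ u in b..N, rtailI F u) ≤ K * b * rtailI F b := fun N hN => by
    have h := hG.integral_mul_le_of_dilation_le (rtailI_nonneg F) ht hb0
      (fun u hu => rtailI_dilation_le hint ht0 fun v hv => hb₁ v (hbb₁.trans (hu.trans hv))) hN
    rw [hct2, sub_sub_cancel, mul_div_assoc', div_le_iff₀ hK] at h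
    have ht1 : 0 < t - 1 := by linarith
    refine le_of_mul_le_mul_right (h.trans_eq ?_) ht1
    ring
  have hterm : ∀ k, 0 ≤ pk F μ r (k + 1) b * (nseq r (k + 1) : ℝ) := fun k =>
    mul_nonneg (pk_nonneg hG hμ.le hr _ _) (Nat.cast_nonneg _)
  have hpartial := sum_pk_mul_nseq_le hG hμ hr hGb hKint
  refine ⟨summable_of_sum_range_le hterm hpartial,
    (Real.tsum_le_of_sum_range_le hterm hpartial).trans ?_⟩
  have hmain : r / μ * (K * b) = (r + ε / 2) / (μ * (α - 2)) * b := by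
    rw [hKdef]; field_simp
  have hr_le : (r : ℝ) ≤ ε / 2 / (μ * (α - 2)) * b := by
    rw [div_lt_iff₀ hε] at hbr
    rw [div_mul_eq_mul_div, le_div_iff₀ (by positivity)]
    linarith
  rw [hmain]
  refine (add_le_add le_rfl hr_le).trans_eq ?_
  field_simp
  ring
end
end
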